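/- arXiv:1505.04908 — 6 statements merged into one kernel-verified Lean document; each statement's English description precedes it below -/
import Mathlib

section
/- Let G be a graph admitting an incidence coloring with Δ(G)+1 colors, and let H be a subgraph of a Δ(H')-regular graph H' that admits an incidence coloring with Δ(H')+1 colors. If Δ(G)+1 ≥ Δ(H') − Δ(H), then the incidence chromatic number of the Cartesian product satisfies χ_i(G □ H) ≤ Δ(G □ H) + 2 (equivalently, χ_i(G □ H) ≤ Δ(G) + Δ(H) + 2). -/
open SimpleGraph

/-- `c v u` is the color of the incidence `(v, vu)` (the incidence of the vertex `v`
with the edge joining `v` and `u`). Two incidences `(v, vu)` and `(x, xy)` are adjacent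
iff `v = x`, or the edges coincide, or the edge `vx` is one of the two edges; this
amounts to `v = x ∨ u = x ∨ v = y`. An incidence coloring assigns distinct colors to
distinct adjacent incidences. -/
def IsIncidenceColoring {V : Type*} (G : SimpleGraph V) {k : ℕ} (c : V → V → Fin k) : Prop :=
  ∀ ⦃v u x y : V⦄, G.Adj v u → G.Adj x y → (v, u) ≠ (x, y) →
    (v = x ∨ u = x ∨ v = y) → c v u ≠ c x y

/-- `G` admits an incidence coloring with `k` colors. -/
def HasIncidenceColoring {V : Type*} (G : SimpleGraph V) (k : ℕ) : Prop :=
  ∃ c : V → V → Fin k, IsIncidenceColoring G c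

/-- The incidence chromatic number of `G`. -/
noncomputable def incChromNum {V : Type*} (G : SimpleGraph V) : ℕ :=
  sInf {k | HasIncidenceColoring G k}

/-- In a regular graph of degree `d` with an incidence coloring by `d + 1` colors, all incidences
pointing to a vertex share a color; this yields a proper coloring of the square of the graph. -/
theorem HasIncidenceColoring.exists_square_coloring {V : Type*} [Fintype V] (G : SimpleGraph V)
    [DecidableRel G.Adj] {d : ℕ} (hreg : G.IsRegularOfDegree d)
    (h : HasIncidenceColoring G (d + 1)) :
    ∃ p : V → Fin (d + 1), (∀ u v, G.Adj u v → p u ≠ p v) ∧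
      ∀ u v w, G.Adj u v → G.Adj u w → v ≠ w → p v ≠ p w := by
  obtain ⟨c, hc⟩ := h
  have hcard (v : V) : ((G.neighborFinset v).image (c v)).card = d := by
    rw [Finset.card_image_of_injOn, card_neighborFinset_eq_degree, hreg v]
    intro a ha b hb hab
    by_contra hne
    simp only [Finset.mem_coe, mem_neighborFinset] at ha hb
    exact hc ha hb (by simpa using hne) (Or.inl rfl) hab
  have hcompl (v : V) : ((G.neighborFinset v).image (c v))ᶜ.card = 1 := by
    rw [Finset.card_compl, hcard, Fintype.card_fin]
    omega
  choose p hp using fun v => Finset.card_eq_one.mp (hcompl v)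
  have hpc {u v : V} (huv : G.Adj u v) : c u v = p v := by
    rw [← Finset.mem_singleton, ← hp v, Finset.mem_compl, Finset.mem_image]
    rintro ⟨w, hw, heq⟩
    rw [mem_neighborFinset] at hw
    exact hc huv hw (fun h => huv.ne (congrArg Prod.fst h)) (Or.inr (Or.inl rfl)) heq.symm
  refine ⟨p, fun u v huv heq => ?_, fun u v w huv huw hne heq => ?_⟩
  · have hmem : p u ∈ ((G.neighborFinset u).image (c u))ᶜ := by simp [hp u]
    rw [Finset.mem_compl, Finset.mem_image] at hmem
    exact hmem ⟨v, by simpa using huv, by rw [hpc huv, heq]⟩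
  · rw [← hpc huv, ← hpc huw] at heq
    exact hc huv huw (by simpa using hne) (Or.inl rfl) heq

/-- An incidence coloring of `G` and a coloring of the square of `H` combine to an incidence
coloring of `G □ H`, by recoloring the copy of `G` over `w` with colors not used on the closed
neighborhood of `w`. -/
theorem HasIncidenceColoring.boxProd {U W : Type*} [Fintype W] (G : SimpleGraph U)
    (H : SimpleGraph W) [DecidableRel H.Adj] {n k : ℕ} (hG : HasIncidenceColoring G n)
    (hk : n + (H.maxDegree + 1) ≤ k) (p : W → Fin k) (hp : ∀ u v, H.Adj u v → p u ≠ p v)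
    (hp' : ∀ u v w, H.Adj u v → H.Adj u w → v ≠ w → p v ≠ p w) :
    HasIncidenceColoring (G.boxProd H) k := by
  classical
  obtain ⟨c, hc⟩ := hG
  have hemb (w : W) : ∃ e : Fin n ↪ Fin k,
      ∀ i, e i ≠ p w ∧ ∀ w', H.Adj w w' → e i ≠ p w' := by
    let S : Finset (Fin k) := (insert w (H.neighborFinset w)).image p
    have hS : S.card ≤ H.maxDegree + 1 := by
      refine Finset.card_image_le.trans ((Finset.card_insert_le _ _).trans ?_)
      rw [card_neighborFinset_eq_degree]
      exact Nat.succ_le_succ (H.degree_le_maxDegree w)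
    have hle : Fintype.card (Fin n) ≤ Fintype.card {x // x ∈ Sᶜ} := by
      rw [Fintype.card_coe, Finset.card_compl, Fintype.card_fin, Fintype.card_fin]
      omega
    obtain ⟨e⟩ := Function.Embedding.nonempty_of_card_le hle
    refine ⟨e.trans (Function.Embedding.subtype _), fun i => ?_⟩
    have hi : ((e i : {x // x ∈ Sᶜ}) : Fin k) ∉ S := Finset.mem_compl.mp (e i).2
    refine ⟨fun h => hi ?_, fun w' hw h => hi ?_⟩
    · exact Finset.mem_image.mpr ⟨w, by simp, h.symm⟩
    · exact Finset.mem_image.mpr ⟨w', by simp [hw], h.symm⟩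
  choose e he he' using hemb
  refine ⟨fun a b => if a.1 = b.1 then p b.2 else e a.2 (c a.1 b.1), ?_⟩
  rintro ⟨v, v'⟩ ⟨u, u'⟩ ⟨x, x'⟩ ⟨y, y'⟩ h₁ h₂ hne hadj
  simp only [boxProd_adj] at h₁ h₂
  rcases h₁ with ⟨h₁, rfl⟩ | ⟨h₁, rfl⟩ <;> rcases h₂ with ⟨h₂, rfl⟩ | ⟨h₂, rfl⟩
  · have hw : v' = x' := by
      rcases hadj with h | h | h <;> simp_all
    subst hw
    simp only [h₁.ne, h₂.ne, if_false]
    refine fun h => hc h₁ h₂ ?_ ?_ ((e v').injective h)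
    · simpa using hne
    · simpa using hadj
  · simp only [h₁.ne, if_false, if_true]
    rcases hadj with h | h | h <;> obtain ⟨rfl, rfl⟩ := Prod.mk.inj h
    · exact he' _ _ _ h₂
    · exact he' _ _ _ h₂
    · exact he _ _
  · simp only [h₂.ne, if_false, if_true]
    rcases hadj with h | h | h <;> obtain ⟨rfl, rfl⟩ := Prod.mk.inj h
    · exact (he' _ _ _ h₁).symm
    · exact (he _ _).symm
    · exact (he' _ _ _ h₁).symm
  · simp only [if_true]
    rcases hadj with h | h | h <;> obtain ⟨rfl, rfl⟩ := Prod.mk.inj h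
    · exact hp' _ _ _ h₁ h₂ (by simpa using hne)
    · exact hp _ _ h₂
    · exact (hp _ _ h₁).symm

/-- If `G` is a `(Δ+1)`-graph and `H` is a subgraph of a regular `(Δ+1)`-graph `H'`
with `Δ(G) + 1 ≥ Δ(H') - Δ(H)`, then `χ_i(G □ H) ≤ Δ(G □ H) + 2 = Δ(G) + Δ(H) + 2`. -/
theorem stmt0 {U W W' : Type*} [Fintype U] [Fintype W] [Fintype W']
    (G : SimpleGraph U) (H : SimpleGraph W) (H' : SimpleGraph W')
    [DecidableRel G.Adj] [DecidableRel H.Adj] [DecidableRel H'.Adj]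
    (hG : HasIncidenceColoring G (G.maxDegree + 1))
    (hreg : H'.IsRegularOfDegree H'.maxDegree)
    (hH' : HasIncidenceColoring H' (H'.maxDegree + 1))
    (hsub : ∃ f : H →g H', Function.Injective f)
    (hdeg : G.maxDegree + 1 ≥ H'.maxDegree - H.maxDegree) :
    incChromNum (G.boxProd H) ≤ G.maxDegree + H.maxDegree + 2 := by
  obtain ⟨f, hf⟩ := hsub
  obtain ⟨p, hp, hp'⟩ := hH'.exists_square_coloring H' hreg
  have hle : H'.maxDegree + 1 ≤ G.maxDegree + H.maxDegree + 2 := by omega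
  refine Nat.sInf_le (hG.boxProd G H (by omega) (fun w => Fin.castLE hle (p (f w))) ?_ ?_)
  · exact fun u v huv h => hp _ _ (f.map_adj huv) (Fin.castLE_injective hle h)
  · exact fun u v w huv huw hne h =>
      hp' _ _ _ (f.map_adj huv) (f.map_adj huw) (hf.ne hne) (Fin.castLE_injective hle h)
end

section
/- Let G be a d-regular graph (with d ≥ 1) and let c be an incidence coloring of G using exactly d+1 colors. Then for every vertex v of G there is a color c_v such that c(u,uv) = c_v for every edge uv incident to v. -/
open SimpleGraph

namespace IsIncidenceColoring

variable {V : Type*} {G : SimpleGraph V} {k : ℕ} {c : V → V → Fin k}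

/-- Distinct incidences at the same vertex receive distinct colors. -/
theorem injOn_neighborSet (hc : IsIncidenceColoring G c) (v : V) :
    Set.InjOn (c v) (G.neighborSet v) := fun _ hu _ hw h ↦
  by_contra fun hne ↦ hc hu hw (fun e ↦ hne (congrArg Prod.snd e)) (Or.inl rfl) h

/-- An incidence towards `v` is colored differently from every incidence at `v`. -/
theorem ne_of_adj (hc : IsIncidenceColoring G c) {u v w : V} (huv : G.Adj u v)
    (hvw : G.Adj v w) : c u v ≠ c v w :=
  hc huv hvw (fun e ↦ huv.ne (congrArg Prod.fst e)) (Or.inr (Or.inl rfl))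

end IsIncidenceColoring

/-- For a `d`-regular graph (`d ≥ 1`) with an incidence coloring using exactly `d + 1`
colors, every vertex `v` has a color `cv` such that all incidences `(u, uv)` towards `v`
are colored `cv`. -/
theorem stmt3 {V : Type*} [Fintype V] (G : SimpleGraph V) [DecidableRel G.Adj]
    (d : ℕ) (hd : 1 ≤ d) (hreg : G.IsRegularOfDegree d)
    (c : V → V → Fin (d + 1)) (hc : IsIncidenceColoring G c) :
    ∀ v : V, ∃ cv : Fin (d + 1), ∀ u : V, G.Adj u v → c u v = cv := by
  intro v
  have hcard : ((G.neighborFinset v).image (c v)).card = d := by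
    rw [Finset.card_image_of_injOn (by simpa using hc.injOn_neighborSet v),
      G.card_neighborFinset_eq_degree, hreg v]
  have hcompl : ((G.neighborFinset v).image (c v))ᶜ.card = 1 := by
    rw [Finset.card_compl, hcard, Fintype.card_fin, Nat.add_sub_cancel_left]
  obtain ⟨cv, hcv⟩ := Finset.card_eq_one.mp hcompl
  refine ⟨cv, fun u huv ↦ Finset.mem_singleton.mp (hcv ▸ Finset.mem_compl.mpr fun hmem ↦ ?_)⟩
  obtain ⟨w, hw, h⟩ := Finset.mem_image.mp hmem
  exact hc.ne_of_adj huv ((G.mem_neighborFinset v w).mp hw) h.symm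
end

section
/- Every d-regular graph G (d ≥ 1) that admits an incidence coloring with d+1 colors admits a (d+1,1)-incidence coloring, i.e., an incidence coloring c with d+1 colors in which |S_c^1(v)| ≤ 1 for every vertex v. -/
open SimpleGraph

/-- In an incidence coloring with `d + 1` colors, the incidences at a vertex `v` of degree `d`
use `d` colors, so that a single color is left for all the incidences towards `v`. -/
theorem IsIncidenceColoring.color_toward_eq {V : Type*} {G : SimpleGraph V} {d : ℕ}
    {c : V → V → Fin (d + 1)} (hc : IsIncidenceColoring G c) {v u w : V}
    [Fintype (G.neighborSet v)] (hdeg : G.degree v = d) (hu : G.Adj u v) (hw : G.Adj w v) :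
    c u v = c w v := by
  have hcard : ((G.neighborFinset v).image (c v)).card = d := by
    rw [Finset.card_image_of_injOn, card_neighborFinset_eq_degree, hdeg]
    intro x hx y hy hxy
    by_contra hne
    exact hc (by simpa using hx) (by simpa using hy) (by simpa using hne) (Or.inl rfl) hxy
  have hmem : ∀ x, G.Adj x v → c x v ∈ ((G.neighborFinset v).image (c v))ᶜ := by
    intro x hx
    simp only [Finset.mem_compl, Finset.mem_image, mem_neighborFinset, not_exists, not_and]
    exact fun y hy hxy ↦
      hc hx hy (fun h ↦ hx.ne (congrArg Prod.fst h)) (Or.inr (Or.inl rfl)) hxy.symm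
  have hle : ((G.neighborFinset v).image (c v))ᶜ.card ≤ 1 := by
    simp [Finset.card_compl, hcard]
  exact Finset.card_le_one.mp hle _ (hmem u hu) _ (hmem w hw)

/-- Every `d`-regular graph (`d ≥ 1`) admitting an incidence coloring with `d + 1` colors
admits a `(d+1, 1)`-incidence coloring, i.e. one in which for each vertex `v` all the
incidences `(u, uv)` towards `v` get the same color (`|S_c^1(v)| ≤ 1`). -/
theorem stmt4 {V : Type*} [Fintype V] (G : SimpleGraph V) [DecidableRel G.Adj]
    (d : ℕ) (hd : 1 ≤ d) (hreg : G.IsRegularOfDegree d)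
    (h : HasIncidenceColoring G (d + 1)) :
    ∃ c : V → V → Fin (d + 1), IsIncidenceColoring G c ∧
      ∀ v u w : V, G.Adj u v → G.Adj w v → c u v = c w v := by
  obtain ⟨c, hc⟩ := h
  exact ⟨c, hc, fun v _ _ hu hw ↦ hc.color_toward_eq (hreg v) hu hw⟩
end

section
/- A simple graph G admits a (k,1)-incidence coloring if and only if G admits a locally injective homomorphism to the complete graph K_k. -/
open SimpleGraph

/-- A graph admits a `(k,1)`-incidence coloring iff it admits a locally injective
homomorphism to the complete graph `K_k`. -/
theorem stmt5 {V : Type*} (G : SimpleGraph V) (k : ℕ) :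
    (∃ c : V → V → Fin k, IsIncidenceColoring G c ∧
      ∀ v u w : V, G.Adj u v → G.Adj w v → c u v = c w v) ↔
    (∃ f : G →g completeGraph (Fin k), ∀ v : V, Set.InjOn f (G.neighborSet v)) := by
  constructor
  · rintro ⟨c, hc, h1⟩
    have key : ∀ v : V, ∃ a : Fin k, ∀ u, G.Adj u v → c u v = a := by
      intro v
      by_cases h : ∃ u, G.Adj u v
      · obtain ⟨w, hw⟩ := h
        exact ⟨c w v, fun u hu => h1 v u w hu hw⟩
      · exact ⟨c v v, fun u hu => absurd ⟨u, hu⟩ h⟩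
    choose f hf using key
    refine ⟨⟨f, fun {x y} hxy => ?_⟩, fun v a ha b hb hab => ?_⟩
    · change f x ≠ f y
      rw [← hf x y hxy.symm, ← hf y x hxy]
      exact hc hxy.symm hxy (fun h => hxy.ne (Prod.ext_iff.mp h).2) (Or.inr (Or.inl rfl))
    · change f a = f b at hab
      rw [← hf a v ha, ← hf b v hb] at hab
      by_contra hne
      exact hc ha hb (fun h => hne (Prod.ext_iff.mp h).2) (Or.inl rfl) hab
  · rintro ⟨f, hf⟩
    refine ⟨fun _ u => f u, ?_, fun _ _ _ _ _ => rfl⟩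
    rintro v u x y hvu hxy hne (rfl | rfl | rfl) h
    · exact hne (Prod.ext rfl (hf v hvu hxy h))
    · exact f.map_adj hxy h
    · exact f.map_adj hvu h.symm
end

section
/- If a simple graph G admits a locally injective homomorphism to the graph obtained from the complete graph on Δ(G)+1 vertices by adding a loop at one vertex, then G is 2-adjustable, i.e., G admits an adjustable incidence coloring with Δ(G)+2 colors. -/
open SimpleGraph

/-- The adjacency relation of `K̊_n`, the complete graph on `Fin n` with a loop added at
the distinguished vertex `0`: `x` and `y` are adjacent iff `x ≠ y`, or `x = y = 0`. -/
def loopedCompleteAdj {n : ℕ} [NeZero n] (x y : Fin n) : Prop :=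
  x ≠ y ∨ (x = 0 ∧ y = 0)

/-- Splitting the color of the looped vertex into `0` and `last` turns a locally injective
homomorphism to the looped complete graph into a proper coloring with one more color. -/
lemma exists_proper_split {V : Type*} [Fintype V] (G : SimpleGraph V) {n : ℕ}
    (f : V → Fin (n + 1)) (hhom : ∀ u v : V, G.Adj u v → loopedCompleteAdj (f u) (f v))
    (hinj : ∀ v : V, Set.InjOn f (G.neighborSet v)) :
    ∃ g : V → Fin (n + 2), (∀ u v, G.Adj u v → g u ≠ g v) ∧
      (∀ u, g u = (f u).castSucc ∨ f u = 0 ∧ g u = Fin.last (n + 1)) := by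
  classical
  let e := Fintype.equivFin V
  let P : V → Prop := fun v => f v = 0 ∧ ∃ w, G.Adj v w ∧ f w = 0 ∧ e w < e v
  have hP : ∀ u v, G.Adj u v → f u = 0 → f v = 0 → e u < e v → P v ∧ ¬ P u := by
    intro u v h hu hv hlt
    refine ⟨⟨hv, u, h.symm, hu, hlt⟩, ?_⟩
    rintro ⟨-, w, hw, hw0, hwlt⟩
    have : w = v := hinj u hw h (hw0.trans hv.symm)
    subst this
    exact absurd hlt hwlt.asymm
  let g : V → Fin (n + 2) := fun v => if P v then Fin.last (n + 1) else (f v).castSucc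
  have hne : ∀ v, (f v).castSucc ≠ Fin.last (n + 1) := fun v => (Fin.castSucc_lt_last _).ne
  have hlt : ∀ u v, G.Adj u v → f u = 0 → f v = 0 → e u < e v → g u ≠ g v := by
    intro u v h hu hv huv
    obtain ⟨h₁, h₂⟩ := hP u v h hu hv huv
    simp only [g, if_pos h₁, if_neg h₂]
    exact hne u
  refine ⟨g, fun u v h => ?_, fun u => ?_⟩
  · rcases hhom u v h with hf | ⟨hu, hv⟩
    · by_cases hu : P u <;> by_cases hv : P v <;> simp only [g, hu, hv, if_true, if_false]
      · exact absurd (hu.1.trans hv.1.symm) hf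
      · exact (hne v).symm
      · exact hne u
      · exact fun h' => hf (Fin.castSucc_injective _ h')
    · rcases lt_or_gt_of_ne (e.injective.ne h.ne) with h' | h'
      · exact hlt u v h hu hv h'
      · exact (hlt v u h.symm hv hu h').symm
  · by_cases hu : P u
    · exact Or.inr ⟨hu.1, if_pos hu⟩
    · exact Or.inl (if_neg hu)

/-- If a graph `G` admits a locally injective homomorphism `f` to `K̊_{Δ(G)+1}` (the
complete graph on `Δ(G)+1` vertices with a loop at one vertex), then `G` is
`2`-adjustable: it admits an incidence coloring `c` with `Δ(G) + 2` colors together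
with two distinct free colors `x, y` such that no vertex `v` has both `x` and `y`
in `S_c^0(v)`. -/
theorem stmt10 {V : Type*} [Fintype V] (G : SimpleGraph V) [DecidableRel G.Adj]
    (f : V → Fin (G.maxDegree + 1))
    (hhom : ∀ u v : V, G.Adj u v → loopedCompleteAdj (f u) (f v))
    (hinj : ∀ v : V, Set.InjOn f (G.neighborSet v)) :
    ∃ c : V → V → Fin (G.maxDegree + 2), IsIncidenceColoring G c ∧
      ∃ x y : Fin (G.maxDegree + 2), x ≠ y ∧
        ∀ v u w : V, G.Adj v u → G.Adj v w → ¬(c v u = x ∧ c v w = y) := by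
  obtain ⟨g, hg, hgf⟩ := exists_proper_split G f hhom hinj
  have hne : ∀ v, (f v).castSucc ≠ Fin.last (G.maxDegree + 1) :=
    fun v => (Fin.castSucc_lt_last _).ne
  have hfg : ∀ u w, g u = g w → f u = f w := by
    intro u w h
    rcases hgf u with hu | ⟨hu, hu'⟩ <;> rcases hgf w with hw | ⟨hw, hw'⟩
    · exact Fin.castSucc_injective _ (hu.symm.trans (h.trans hw))
    · exact absurd (hu.symm.trans (h.trans hw')) (hne u)
    · exact absurd (hw.symm.trans (h.symm.trans hu')) (hne w)
    · exact hu.trans hw.symm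
  have h0 : (0 : Fin (G.maxDegree + 2)) ≠ Fin.last (G.maxDegree + 1) := (Fin.last_pos).ne
  refine ⟨fun _ u => g u, ?_, 0, Fin.last _, h0, ?_⟩
  · rintro v u x y hvu hxy hdist (rfl | rfl | rfl) h
    · exact hdist (by rw [hinj v hvu hxy (hfg u y h)])
    · exact hg _ _ hxy h
    · exact hg _ _ hvu h.symm
  · rintro v u w hu hw ⟨hu0, hwl⟩
    have hfu : f u = 0 := by
      rcases hgf u with h | ⟨h, -⟩
      · exact Fin.castSucc_injective _ (h.symm.trans hu0)
      · exact h
    have hfw : f w = 0 := by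
      rcases hgf w with h | ⟨h, -⟩
      · exact absurd (h.symm.trans hwl) (hne w)
      · exact h
    have huw : u = w := hinj v hu hw (hfu.trans hfw.symm)
    subst huw
    exact h0 (hu0.symm.trans hwl)
end

section
/- For every integer n ≥ 1, χ_{i,1}(K_{n,n}) = 2n, where K_{n,n} is the complete bipartite graph with parts of size n. -/
open SimpleGraph

/-- A `(k,1)`-incidence coloring: an incidence coloring with `k` colors such that
`|S_c^1(v)| ≤ 1` for every vertex `v`. -/
def IsIncidenceColoring1 {V : Type*} (G : SimpleGraph V) {k : ℕ} (c : V → V → Fin k) : Prop :=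
  IsIncidenceColoring G c ∧ ∀ v u w : V, G.Adj u v → G.Adj w v → c u v = c w v

/-- `χ_{i,1}(G)`: the least `k` such that `G` has a `(k,1)`-incidence coloring. -/
noncomputable def incChrom1Num {V : Type*} (G : SimpleGraph V) : ℕ :=
  sInf {k | ∃ c : V → V → Fin k, IsIncidenceColoring1 G c}

/-- Coloring each incidence `(v, vu)` by the vertex `u` is an incidence coloring in which all
incidences `(u, uv)` at a given `v` share one color. -/
theorem isIncidenceColoring1_of_injective {V : Type*} (G : SimpleGraph V) {k : ℕ} {f : V → Fin k}
    (hf : Function.Injective f) : IsIncidenceColoring1 G fun _ u => f u := by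
  refine ⟨?_, fun _ _ _ _ _ => rfl⟩
  rintro v u x y hvu hxy hne hadj hc
  obtain rfl := hf hc
  rcases hadj with rfl | rfl | rfl
  · exact hne rfl
  · exact hxy.ne rfl
  · exact hvu.ne rfl

/-- If every vertex has a neighbor and any two distinct vertices are adjacent or have a common
neighbor, then a `(k,1)`-incidence coloring uses at least as many colors as there are vertices. -/
theorem IsIncidenceColoring1.card_le {V : Type*} [Fintype V] {G : SimpleGraph V} {k : ℕ}
    {c : V → V → Fin k} (hc : IsIncidenceColoring1 G c) (hG : ∀ v, ∃ u, G.Adj u v)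
    (hdiam : ∀ v w, v ≠ w → G.Adj v w ∨ ∃ u, G.Adj u v ∧ G.Adj u w) :
    Fintype.card V ≤ k := by
  choose g hg using hG
  have hinj : Function.Injective fun v => c (g v) v := by
    intro v w h
    by_contra hvw
    rcases hdiam v w hvw with hadj | ⟨u, huv, huw⟩
    · refine hc.1 hadj.symm hadj (by simp [Ne.symm hvw]) (.inr (.inl rfl)) ?_
      rw [hc.2 v w (g v) hadj.symm (hg v), hc.2 w v (g w) hadj (hg w)]
      exact h
    · refine hc.1 huv huw (by simp [hvw]) (.inl rfl) ?_
      rw [hc.2 v u (g v) huv (hg v), hc.2 w u (g w) huw (hg w)]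
      exact h
  simpa using Fintype.card_le_of_injective _ hinj

/-- For every `n ≥ 1`, `χ_{i,1}(K_{n,n}) = 2n`. -/
theorem stmt13 (n : ℕ) (hn : 1 ≤ n) :
    incChrom1Num (completeBipartiteGraph (Fin n) (Fin n)) = 2 * n := by
  have hcard : Fintype.card (Fin n ⊕ Fin n) = 2 * n := by simp [two_mul]
  have : NeZero n := ⟨by omega⟩
  have hmem : 2 * n ∈ {k | ∃ c : Fin n ⊕ Fin n → Fin n ⊕ Fin n → Fin k,
      IsIncidenceColoring1 (completeBipartiteGraph (Fin n) (Fin n)) c} :=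
    ⟨_, isIncidenceColoring1_of_injective _ (Fintype.equivFinOfCardEq hcard).injective⟩
  refine le_antisymm (Nat.sInf_le hmem) (le_csInf ⟨_, hmem⟩ ?_)
  rintro k ⟨c, hc⟩
  rw [← hcard]
  refine hc.card_le ?_ ?_
  · rintro (i | j)
    · exact ⟨.inr 0, by simp⟩
    · exact ⟨.inl 0, by simp⟩
  · rintro (i | i) (j | j) -
    · exact .inr ⟨.inr 0, by simp⟩
    · exact .inl (by simp)
    · exact .inl (by simp)
    · exact .inr ⟨.inl 0, by simp⟩
end
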